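/- Let H be a real inner product space, n a natural number, and A : Fin n → H a family of pairwise orthogonal vectors with Y = ∑_i A_i ≠ 0. Fix k ≤ n and let Ŝ ⊆ Fin n be a subset of cardinality k such that ‖A_i‖² ≥ ‖A_j‖² for every i ∈ Ŝ and j ∉ Ŝ (i.e., Ŝ consists of k indices with the largest singleton fidelity scores). Then for every subset S ⊆ Fin n of cardinality k, FS(S) ≤ FS(Ŝ); that is, selecting the top-k components by singleton fidelity yields a Maximum Fidelity Subset of size k. -/

import Mathlib

open scoped RealInnerProductSpace
open Finset

/-- The Subset Fidelity of a subset `C` of components `A : Fin n → H`: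
`FS(C) = 1 − (⨅ over δ supported on C of ‖Y − ∑_{i ∈ C} δ i • A i‖²) / ‖Y‖²`,
where `Y = ∑ i, A i`. -/
noncomputable def subsetFidelity {H : Type*} [NormedAddCommGroup H] [InnerProductSpace ℝ H]
    {n : ℕ} (A : Fin n → H) (C : Finset (Fin n)) : ℝ :=
  1 - (⨅ δ : {δ : Fin n → ℝ // ∀ i ∉ C, δ i = 0},
        ‖(∑ i, A i) - ∑ i ∈ C, (δ : Fin n → ℝ) i • A i‖ ^ 2) / ‖∑ i, A i‖ ^ 2

/-- The Pythagorean theorem for a finite family of pairwise orthogonal vectors. -/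
theorem norm_sq_sum_smul_of_orthogonal {ι H : Type*} [NormedAddCommGroup H]
    [InnerProductSpace ℝ H] (A : ι → H) (horth : ∀ i j, i ≠ j → ⟪A i, A j⟫ = 0)
    (s : Finset ι) (c : ι → ℝ) :
    ‖∑ i ∈ s, c i • A i‖ ^ 2 = ∑ i ∈ s, c i ^ 2 * ‖A i‖ ^ 2 := by
  rw [← real_inner_self_eq_norm_sq, sum_inner]
  refine sum_congr rfl fun i hi => ?_
  rw [inner_sum, sum_eq_single_of_mem i hi]
  · rw [real_inner_smul_left, real_inner_smul_right, real_inner_self_eq_norm_sq]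
    ring
  · intro j _ hj
    rw [real_inner_smul_left, real_inner_smul_right, horth i j hj.symm]
    ring

/-- For orthogonal components, the best approximation supported on `C` leaves exactly the
energy of the components outside `C`. -/
theorem iInf_residual_of_orthogonal {H : Type*} [NormedAddCommGroup H] [InnerProductSpace ℝ H]
    {n : ℕ} (A : Fin n → H) (horth : ∀ i j, i ≠ j → ⟪A i, A j⟫ = 0) (C : Finset (Fin n)) :
    (⨅ δ : {δ : Fin n → ℝ // ∀ i ∉ C, δ i = 0},
        ‖(∑ i, A i) - ∑ i ∈ C, (δ : Fin n → ℝ) i • A i‖ ^ 2) = ∑ i ∈ Cᶜ, ‖A i‖ ^ 2 := by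
  have hres (δ : {δ : Fin n → ℝ // ∀ i ∉ C, δ i = 0}) :
      ‖(∑ i, A i) - ∑ i ∈ C, (δ : Fin n → ℝ) i • A i‖ ^ 2 =
        ∑ i ∈ C, (1 - (δ : Fin n → ℝ) i) ^ 2 * ‖A i‖ ^ 2 + ∑ i ∈ Cᶜ, ‖A i‖ ^ 2 := by
    have hext : ∑ i ∈ C, (δ : Fin n → ℝ) i • A i = ∑ i, (δ : Fin n → ℝ) i • A i :=
      sum_subset (subset_univ C) fun i _ hi => by rw [δ.2 i hi, zero_smul]
    have hsub : (∑ i, A i) - ∑ i, (δ : Fin n → ℝ) i • A i =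
        ∑ i, (1 - (δ : Fin n → ℝ) i) • A i := by
      simp only [sub_smul, one_smul, sum_sub_distrib]
    rw [hext, hsub, norm_sq_sum_smul_of_orthogonal A horth, ← sum_add_sum_compl C]
    congr 1
    refine sum_congr rfl fun i hi => ?_
    rw [δ.2 i (mem_compl.mp hi)]
    ring
  simp only [hres]
  refine IsLeast.csInf_eq ⟨⟨⟨fun i => if i ∈ C then 1 else 0, fun i hi => if_neg hi⟩, ?_⟩, ?_⟩
  · simp +contextual [sum_eq_zero]
  · rintro _ ⟨δ, rfl⟩
    exact le_add_of_nonneg_left (sum_nonneg fun i _ => by positivity)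

/-- A finset whose values of `f` dominate all values outside it maximizes the sum of `f` among
finsets of the same cardinality. -/
theorem sum_le_sum_of_card_eq_of_forall_notMem_le {ι : Type*} [DecidableEq ι] (f : ι → ℝ)
    {s t : Finset ι} (hcard : s.card = t.card) (h : ∀ i ∈ t, ∀ j ∉ t, f j ≤ f i) :
    ∑ i ∈ s, f i ≤ ∑ i ∈ t, f i := by
  rw [← sum_sdiff_le_sum_sdiff]
  have hcard' : (s \ t).card = (t \ s).card := card_sdiff_comm hcard
  rcases (s \ t).eq_empty_or_nonempty with he | hne
  · rw [he, card_empty, eq_comm, card_eq_zero] at hcard'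
    rw [he, hcard']
  · obtain ⟨j, hj, hmax⟩ := exists_max_image (s \ t) f hne
    calc ∑ i ∈ s \ t, f i ≤ (s \ t).card • f j := sum_le_card_nsmul _ _ _ hmax
      _ = (t \ s).card • f j := by rw [hcard']
      _ ≤ ∑ i ∈ t \ s, f i := card_nsmul_le_sum _ _ _ fun i hi =>
          h i (mem_sdiff.mp hi).1 j (mem_sdiff.mp hj).2

/-- For a pairwise orthogonal family, selecting the `k` components with the largest
singleton scores `‖A i‖²` yields a Maximum Fidelity Subset of size `k`: any set `Ŝ`
of cardinality `k` with `‖A i‖² ≥ ‖A j‖²` for all `i ∈ Ŝ`, `j ∉ Ŝ`, satisfies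
`FS(S) ≤ FS(Ŝ)` for every subset `S` of cardinality `k`. -/
theorem topk_singleton_optimal {H : Type*} [NormedAddCommGroup H]
    [InnerProductSpace ℝ H] {n : ℕ} (A : Fin n → H)
    (horth : ∀ i j, i ≠ j → ⟪A i, A j⟫ = 0) (hY : (∑ i, A i) ≠ 0)
    (k : ℕ) (hk : k ≤ n) (Shat : Finset (Fin n)) (hcard : Shat.card = k)
    (htop : ∀ i ∈ Shat, ∀ j ∉ Shat, ‖A j‖ ^ 2 ≤ ‖A i‖ ^ 2) :
    ∀ S : Finset (Fin n), S.card = k → subsetFidelity A S ≤ subsetFidelity A Shat := by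
  intro S hS
  have hsum := sum_le_sum_of_card_eq_of_forall_notMem_le (fun i => ‖A i‖ ^ 2)
    (hS.trans hcard.symm) htop
  have hSplit := sum_add_sum_compl S fun i => ‖A i‖ ^ 2
  have hShatSplit := sum_add_sum_compl Shat fun i => ‖A i‖ ^ 2
  unfold subsetFidelity
  rw [iInf_residual_of_orthogonal A horth, iInf_residual_of_orthogonal A horth]
  gcongr 1 - ?_ / _
  linarith
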